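/- Assume Ŝ_O is nonempty and Ŝ_O ⊆ Cn(S_O). Define R_sem(D) as the infimum of I(p,W) over all test channels W from S_O to Ŝ_O with expected closure distortion Σ_{s,ŝ} p(s)·W(ŝ|s)·d_Cn(s,ŝ) ≤ D, and define the core sub-source rate–distortion function R^{(A)}(D') as the infimum of I(π_A, V) over all test channels V from A to Ŝ_O with Σ_{a,ŝ} π_A(a)·V(ŝ|a)·d_Cn(a,ŝ) ≤ D'. Then for every D ≥ 0: if P_A = 0 then R_sem(D) = 0, and if P_A > 0 then R_sem(D) = P_A · R^{(A)}(D / P_A). In particular, redundant states are invisible to both rate and distortion. -/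

import Mathlib

open scoped BigOperators Classical

noncomputable section

variable {𝕊 : Type*} [Fintype 𝕊]

/-- One step of the deletion procedure. -/
def atomStep (Cn : Set 𝕊 → Set 𝕊) (A : Set 𝕊) (s : 𝕊) : Set 𝕊 :=
  if s ∈ Cn (A \ {s}) then A \ {s} else A

/-- The deletion procedure; `Atom(S_O) = atomCore Cn S_O L`. -/
def atomCore (Cn : Set 𝕊 → Set 𝕊) (S : Set 𝕊) (L : List 𝕊) : Set 𝕊 :=
  L.foldl (atomStep Cn) S

/-- Shannon entropy of a probability vector on a finite type
(natural logarithm; `Real.log 0 = 0` handles the `0·log 0 := 0` convention). -/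
def entropy {X : Type*} [Fintype X] (p : X → ℝ) : ℝ :=
  -∑ x, p x * Real.log (p x)

/-- Mutual information `I(p,W) := H(p) + H(q̂) − H(q)` of a source `p` and a
channel `W`, where `q(x,y) = p(x)·W(y|x)` and `q̂` is the output marginal. -/
def mutualInfo {X Y : Type*} [Fintype X] [Fintype Y]
    (p : X → ℝ) (W : X → Y → ℝ) : ℝ :=
  entropy p + entropy (fun y => ∑ x, p x * W x y)
    - entropy (fun z : X × Y => p z.1 * W z.1 z.2)

/-- A test channel into the alphabet `Yset`: rows are probability vectors
supported inside `Yset`. -/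
def IsChannel {X Y : Type*} [Fintype Y] (W : X → Y → ℝ) (Yset : Set Y) : Prop :=
  (∀ x y, 0 ≤ W x y) ∧ (∀ x, ∑ y, W x y = 1) ∧ (∀ x y, W x y ≠ 0 → y ∈ Yset)

/-- A probability vector supported on `S`. -/
def IsProbVector {X : Type*} [Fintype X] (p : X → ℝ) (S : Set X) : Prop :=
  (∀ x, 0 ≤ p x) ∧ (∑ x, p x = 1) ∧ (∀ x, p x ≠ 0 → x ∈ S)

/-- The probability mass `p(A)` of a set `A`. -/
def massOn {X : Type*} [Fintype X] (p : X → ℝ) (A : Set X) : ℝ :=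
  ∑ x, if x ∈ A then p x else 0

/-- The conditional distribution of `p` given `A`. -/
def condOn {X : Type*} [Fintype X] (p : X → ℝ) (A : Set X) : X → ℝ :=
  fun x => if x ∈ A then p x / massOn p A else 0

/-- Zero-distortion reconstruction set
`R_Cn(s) := {shat ∈ Shat_O : Cn((S_O \ {s}) ∪ {shat}) = Cn(S_O)}`. -/
def RCn (Cn : Set 𝕊 → Set 𝕊) (S_O Shat_O : Set 𝕊) (s : 𝕊) : Set 𝕊 :=
  {shat ∈ Shat_O | Cn ((S_O \ {s}) ∪ {shat}) = Cn S_O}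

/-- The channel `W` achieves zero closure distortion for the source `p`. -/
def ZeroClosureDist (Cn : Set 𝕊 → Set 𝕊) (S_O : Set 𝕊)
    (p : 𝕊 → ℝ) (W : 𝕊 → 𝕊 → ℝ) : Prop :=
  ∀ s : 𝕊, 0 < p s → ∀ shat : 𝕊, 0 < W s shat →
    Cn ((S_O \ {s}) ∪ {shat}) = Cn S_O

/-- `R_sem(0)`: the infimum of `I(p,W)` over all zero-closure-distortion test
channels from `S_O` to `Shat_O` (infimum of the empty set is `⊤ = +∞`). -/
def RsemZero (Cn : Set 𝕊 → Set 𝕊) (S_O Shat_O : Set 𝕊) (p : 𝕊 → ℝ) : EReal :=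
  sInf {r : EReal | ∃ W : 𝕊 → 𝕊 → ℝ, IsChannel W Shat_O ∧
    ZeroClosureDist Cn S_O p W ∧ r = ((mutualInfo p W : ℝ) : EReal)}

/-- Closure (Jaccard) distortion
`d_Cn(s,shat) := 1 − |Cn(S_O) ∩ C_shat| / |Cn(S_O) ∪ C_shat|`, where
`C_shat := Cn((S_O \ {s}) ∪ {shat})`, with the convention `0` when both
closure sets are empty. -/
def dCn (Cn : Set 𝕊 → Set 𝕊) (S_O : Set 𝕊) (s shat : 𝕊) : ℝ :=
  if Cn S_O ∪ Cn ((S_O \ {s}) ∪ {shat}) = ∅ then 0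
  else 1 - ((Cn S_O ∩ Cn ((S_O \ {s}) ∪ {shat})).ncard : ℝ) /
    ((Cn S_O ∪ Cn ((S_O \ {s}) ∪ {shat})).ncard : ℝ)

/-- The closure-based rate–distortion function `R_sem(D)`: the infimum of
`I(p,W)` over test channels from `S_O` to `Shat_O` with expected closure
distortion at most `D` (infimum of the empty set is `⊤ = +∞`). -/
def RsemD (Cn : Set 𝕊 → Set 𝕊) (S_O Shat_O : Set 𝕊) (p : 𝕊 → ℝ) (D : ℝ) :
    EReal :=
  sInf {r : EReal | ∃ W : 𝕊 → 𝕊 → ℝ, IsChannel W Shat_O ∧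
    (∑ s, ∑ shat, p s * W s shat * dCn Cn S_O s shat) ≤ D ∧
    r = ((mutualInfo p W : ℝ) : EReal)}

/-- The core sub-source rate–distortion function `R^{(A)}(D')`: the infimum of
`I(π_A, V)` over test channels from the core to `Shat_O` with expected closure
distortion at most `D'`. -/
def RcoreD (Cn : Set 𝕊 → Set 𝕊) (S_O Shat_O : Set 𝕊) (π : 𝕊 → ℝ) (D' : ℝ) :
    EReal :=
  sInf {r : EReal | ∃ V : 𝕊 → 𝕊 → ℝ, IsChannel V Shat_O ∧
    (∑ a, ∑ shat, π a * V a shat * dCn Cn S_O a shat) ≤ D' ∧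
    r = ((mutualInfo π V : ℝ) : EReal)}

theorem atomStep_subset {𝕊 : Type*} (Cn : Set 𝕊 → Set 𝕊) (A : Set 𝕊) (s : 𝕊) :
    atomStep Cn A s ⊆ A := by
  unfold atomStep
  split_ifs
  · exact Set.sdiff_subset
  · exact subset_rfl

theorem closure_atomStep {𝕊 : Type*} {Cn : Set 𝕊 → Set 𝕊} (hrefl : ∀ Γ : Set 𝕊, Γ ⊆ Cn Γ)
    (hmono : ∀ Γ Γ' : Set 𝕊, Γ ⊆ Γ' → Cn Γ ⊆ Cn Γ') (hidem : ∀ Γ : Set 𝕊, Cn (Cn Γ) = Cn Γ)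
    (A : Set 𝕊) (s : 𝕊) : Cn (atomStep Cn A s) = Cn A := by
  unfold atomStep
  split_ifs with h
  · refine (hmono _ _ Set.sdiff_subset).antisymm ?_
    rw [← hidem (A \ {s})]
    refine hmono _ _ fun x hx => ?_
    by_cases hxs : x = s
    · exact hxs ▸ h
    · exact hrefl _ ⟨hx, hxs⟩
  · rfl

theorem atomCore_subset {𝕊 : Type*} (Cn : Set 𝕊 → Set 𝕊) (S : Set 𝕊) (L : List 𝕊) :
    atomCore Cn S L ⊆ S := by
  induction L generalizing S with
  | nil => exact subset_rfl
  | cons s L ih => exact (ih (atomStep Cn S s)).trans (atomStep_subset Cn S s)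

theorem closure_atomCore {𝕊 : Type*} {Cn : Set 𝕊 → Set 𝕊} (hrefl : ∀ Γ : Set 𝕊, Γ ⊆ Cn Γ)
    (hmono : ∀ Γ Γ' : Set 𝕊, Γ ⊆ Γ' → Cn Γ ⊆ Cn Γ') (hidem : ∀ Γ : Set 𝕊, Cn (Cn Γ) = Cn Γ)
    (S : Set 𝕊) (L : List 𝕊) : Cn (atomCore Cn S L) = Cn S := by
  induction L generalizing S with
  | nil => rfl
  | cons s L ih => exact (ih (atomStep Cn S s)).trans (closure_atomStep hrefl hmono hidem S s)

/-- Replacing a statement outside the core by one in the closure costs no distortion. -/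
theorem dCn_eq_zero_of_notMem_atomCore {Cn : Set 𝕊 → Set 𝕊} (hrefl : ∀ Γ : Set 𝕊, Γ ⊆ Cn Γ)
    (hmono : ∀ Γ Γ' : Set 𝕊, Γ ⊆ Γ' → Cn Γ ⊆ Cn Γ') (hidem : ∀ Γ : Set 𝕊, Cn (Cn Γ) = Cn Γ)
    {S : Set 𝕊} {L : List 𝕊} {s shat : 𝕊} (hs : s ∉ atomCore Cn S L) (hshat : shat ∈ Cn S) :
    dCn Cn S s shat = 0 := by
  have hC : Cn ((S \ {s}) ∪ {shat}) = Cn S := by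
    apply Set.Subset.antisymm
    · conv_rhs => rw [← hidem S]
      refine hmono _ _ (Set.union_subset (Set.sdiff_subset.trans (hrefl S)) ?_)
      exact Set.singleton_subset_iff.2 hshat
    · rw [← closure_atomCore hrefl hmono hidem S L]
      refine hmono _ _ fun x hx => Or.inl ⟨atomCore_subset Cn S L hx, ?_⟩
      rintro rfl
      exact hs hx
  unfold dCn
  rw [hC, Set.union_self, Set.inter_self]
  split_ifs with h
  · rfl
  · have : ((Cn S).ncard : ℝ) ≠ 0 := by
      rw [Nat.cast_ne_zero, Ne, Set.ncard_eq_zero]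
      exact h
    rw [div_self this, sub_self]

section MutualInfo

variable {X Y : Type*} [Fintype X] [Fintype Y]

theorem mutualInfo_eq_sum (p : X → ℝ) {W : X → Y → ℝ} (hW : ∀ x, ∑ y, W x y = 1) :
    mutualInfo p W = ∑ x, p x * ∑ y, W x y * Real.log (W x y)
      - ∑ y, (∑ x, p x * W x y) * Real.log (∑ x, p x * W x y) := by
  have key : ∀ x y, p x * W x y * Real.log (p x * W x y) =
      W x y * (p x * Real.log (p x)) + p x * (W x y * Real.log (W x y)) := by
    intro x y
    by_cases hp : p x = 0
    · simp [hp]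
    by_cases hw : W x y = 0
    · simp [hw]
    rw [Real.log_mul hp hw]
    ring
  unfold mutualInfo entropy
  simp only [Fintype.sum_prod_type, key, Finset.sum_add_distrib, ← Finset.sum_mul, hW,
    ← Finset.mul_sum, one_mul]
  ring

/-- A sub-source `π` carrying mass `P` of the source `p` contributes at most `I(p, W)`. -/
theorem mul_mutualInfo_le {p π : X → ℝ} {P : ℝ} {W : X → Y → ℝ} (hp : ∑ x, p x = 1)
    (hπ : ∀ x, 0 ≤ π x) (hπ1 : ∑ x, π x = 1) (hP : 0 ≤ P) (hle : ∀ x, P * π x ≤ p x)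
    (hW0 : ∀ x y, 0 ≤ W x y) (hW : ∀ x, ∑ y, W x y = 1) :
    P * mutualInfo π W ≤ mutualInfo p W := by
  have jensen : ∀ y, (∑ x, p x * W x y) * Real.log (∑ x, p x * W x y) ≤
      P * ((∑ x, π x * W x y) * Real.log (∑ x, π x * W x y))
        + ∑ x, (p x - P * π x) * (W x y * Real.log (W x y)) := by
    intro y
    have h := Real.convexOn_mul_log.map_sum_le (t := Finset.univ)
      (w := fun o : Option X => o.elim P fun x => p x - P * π x)
      (p := fun o : Option X => o.elim (∑ x, π x * W x y) fun x => W x y)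
      (by
        rintro (_ | x) _
        · exact hP
        · exact sub_nonneg.2 (hle x))
      (by simp [Fintype.sum_option, Finset.sum_sub_distrib, ← Finset.mul_sum, hp, hπ1])
      (by
        rintro (_ | x) _
        · exact Finset.sum_nonneg fun x _ => mul_nonneg (hπ x) (hW0 x y)
        · exact hW0 x y)
    have hmix : P * ∑ x, π x * W x y + ∑ x, (p x - P * π x) * W x y = ∑ x, p x * W x y := by
      rw [Finset.mul_sum, ← Finset.sum_add_distrib]
      exact Finset.sum_congr rfl fun x _ => by ring
    simpa [Fintype.sum_option, hmix] using h
  have hsum := Finset.sum_le_sum fun y (_ : y ∈ Finset.univ) => jensen y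
  rw [Finset.sum_add_distrib, ← Finset.mul_sum, Finset.sum_comm] at hsum
  simp only [← Finset.mul_sum, sub_mul, Finset.sum_sub_distrib, mul_assoc] at hsum
  rw [mutualInfo_eq_sum p hW, mutualInfo_eq_sum π hW]
  linarith

theorem mutualInfo_nonneg {p : X → ℝ} {W : X → Y → ℝ} (hp0 : ∀ x, 0 ≤ p x) (hp : ∑ x, p x = 1)
    (hW0 : ∀ x y, 0 ≤ W x y) (hW : ∀ x, ∑ y, W x y = 1) : 0 ≤ mutualInfo p W := by
  simpa using mul_mutualInfo_le (P := 0) hp hp0 hp le_rfl (by simpa using hp0) hW0 hW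

theorem massOn_mul_condOn {p : X → ℝ} {A : Set X} (hP : massOn p A ≠ 0) (x : X) :
    massOn p A * condOn p A x = if x ∈ A then p x else 0 := by
  unfold condOn
  split_ifs
  · field_simp
  · exact mul_zero _

theorem sum_condOn {p : X → ℝ} {A : Set X} (hP : massOn p A ≠ 0) : ∑ x, condOn p A x = 1 := by
  refine mul_left_cancel₀ hP ?_
  simp only [Finset.mul_sum, massOn_mul_condOn hP, mul_one]
  rfl

/-- The channel using `V` on `A`, and the output law of `V` under `π` independently of the input
off `A`. -/
def extendChannel (A : Set X) (π : X → ℝ) (V : X → Y → ℝ) (x : X) (y : Y) : ℝ :=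
  if x ∈ A then V x y else ∑ a, π a * V a y

theorem IsChannel.extendChannel {A : Set X} {π : X → ℝ} {V : X → Y → ℝ} {Yset : Set Y}
    (hV : IsChannel V Yset) (hπ : ∀ x, 0 ≤ π x) (hπ1 : ∑ x, π x = 1) :
    IsChannel (extendChannel A π V) Yset := by
  obtain ⟨hV0, hV1, hVs⟩ := hV
  refine ⟨fun x y => ?_, fun x => ?_, fun x y => ?_⟩ <;> unfold _root_.extendChannel <;> split_ifs
  · exact hV0 x y
  · exact Finset.sum_nonneg fun a _ => mul_nonneg (hπ a) (hV0 a y)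
  · exact hV1 x
  · rw [Finset.sum_comm]
    simp only [← Finset.mul_sum, hV1, mul_one, hπ1]
  · exact hVs x y
  · intro h
    obtain ⟨a, -, ha⟩ := Finset.exists_ne_zero_of_sum_ne_zero h
    exact hVs a y (right_ne_zero_of_mul ha)

theorem mutualInfo_extendChannel {p : X → ℝ} {A : Set X} {V : X → Y → ℝ} (hp : ∑ x, p x = 1)
    (hP : massOn p A ≠ 0) (hV : ∀ x, ∑ y, V x y = 1) :
    mutualInfo p (extendChannel A (condOn p A) V) = massOn p A * mutualInfo (condOn p A) V := by
  set P := massOn p A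
  set π := condOn p A
  set m : Y → ℝ := fun y => ∑ a, π a * V a y
  have split : ∀ f : X → ℝ, ∀ c : ℝ,
      ∑ x, p x * (if x ∈ A then f x else c) = P * ∑ x, π x * f x + (1 - P) * c := by
    intro f c
    have h1 : P * c = ∑ x, P * π x * c := by
      rw [← Finset.sum_mul, ← Finset.mul_sum, sum_condOn hP, mul_one]
    have h2 : c = ∑ x, p x * c := by rw [← Finset.sum_mul, hp, one_mul]
    rw [sub_mul, one_mul, h1]
    conv_rhs => rw [h2]
    rw [Finset.mul_sum, ← Finset.sum_sub_distrib, ← Finset.sum_add_distrib]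
    refine Finset.sum_congr rfl fun x _ => ?_
    rw [← mul_assoc, massOn_mul_condOn hP]
    split_ifs <;> simp [← h2]
  have hW : ∀ x, ∑ y, extendChannel A π V x y = 1 := by
    intro x
    unfold extendChannel
    split_ifs
    · exact hV x
    · rw [Finset.sum_comm]
      simp only [← Finset.mul_sum, hV, mul_one]
      exact sum_condOn hP
  have hout : ∀ y, ∑ x, p x * extendChannel A π V x y = m y := by
    intro y
    unfold extendChannel
    rw [split]
    ring
  have hrow : ∀ x, ∑ y, extendChannel A π V x y * Real.log (extendChannel A π V x y) =
      if x ∈ A then ∑ y, V x y * Real.log (V x y) else ∑ y, m y * Real.log (m y) := by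
    intro x
    unfold extendChannel
    split_ifs <;> rfl
  rw [mutualInfo_eq_sum p hW, mutualInfo_eq_sum π hV]
  simp only [hout, hrow, split]
  ring

theorem mutualInfo_const {p : X → ℝ} {w : Y → ℝ} (hp : ∑ x, p x = 1) (hw : ∑ y, w y = 1) :
    mutualInfo p (fun _ => w) = 0 := by
  rw [mutualInfo_eq_sum p fun _ => hw]
  simp only [← Finset.sum_mul, hp, one_mul, sub_self]

/-- If `d` vanishes off `A` then expected distortion only sees the sub-source on `A`. -/
theorem sum_distortion_eq {p : X → ℝ} {A : Set X} {W V d : X → Y → ℝ} (hP : massOn p A ≠ 0)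
    (hWV : ∀ x ∈ A, W x = V x) (hd : ∀ x ∉ A, ∀ y, W x y * d x y = 0) :
    ∑ x, ∑ y, p x * W x y * d x y =
      massOn p A * ∑ x, ∑ y, condOn p A x * V x y * d x y := by
  simp only [Finset.mul_sum, ← mul_assoc, massOn_mul_condOn hP]
  refine Finset.sum_congr rfl fun x _ => Finset.sum_congr rfl fun y _ => ?_
  split_ifs with hx
  · rw [hWV x hx]
  · rw [mul_assoc, hd x hx y]
    simp

end MutualInfo

/-- Core decomposition of the full rate–distortion
function: if `Shat_O` is nonempty and `Shat_O ⊆ Cn(S_O)`, then for every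
`D ≥ 0`: if `P_A = 0` then `R_sem(D) = 0`, and if `P_A > 0` then
`R_sem(D) = P_A · R^{(A)}(D / P_A)`. -/
theorem rate_distortion_core_decomposition
    (Cn : Set 𝕊 → Set 𝕊)
    (hrefl : ∀ Γ : Set 𝕊, Γ ⊆ Cn Γ)
    (hmono : ∀ Γ Γ' : Set 𝕊, Γ ⊆ Γ' → Cn Γ ⊆ Cn Γ')
    (hidem : ∀ Γ : Set 𝕊, Cn (Cn Γ) = Cn Γ)
    (S_O Shat_O : Set 𝕊) (L : List 𝕊)
    (hnodup : L.Nodup)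
    (henum : ∀ s : 𝕊, s ∈ L ↔ s ∈ S_O)
    (p : 𝕊 → ℝ) (hp : IsProbVector p S_O)
    (hShatne : Shat_O.Nonempty)
    (hShatsub : Shat_O ⊆ Cn S_O) :
    ∀ D : ℝ, 0 ≤ D →
      (massOn p (atomCore Cn S_O L) = 0 →
        RsemD Cn S_O Shat_O p D = 0) ∧
      (0 < massOn p (atomCore Cn S_O L) →
        RsemD Cn S_O Shat_O p D =
          ((massOn p (atomCore Cn S_O L) : ℝ) : EReal) *
            RcoreD Cn S_O Shat_O (condOn p (atomCore Cn S_O L))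
              (D / massOn p (atomCore Cn S_O L))) := by
  intro D hD
  set A := atomCore Cn S_O L
  obtain ⟨hp0, hp1, -⟩ := hp
  have hd : ∀ W : 𝕊 → 𝕊 → ℝ, IsChannel W Shat_O → ∀ x ∉ A, ∀ y,
      W x y * dCn Cn S_O x y = 0 := by
    intro W hW x hx y
    by_cases hy : W x y = 0
    · rw [hy, zero_mul]
    · rw [dCn_eq_zero_of_notMem_atomCore hrefl hmono hidem hx (hShatsub (hW.2.2 x y hy)),
        mul_zero]
  refine ⟨fun hP => ?_, fun hP => ?_⟩
  · apply le_antisymm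
    · obtain ⟨t, ht⟩ := hShatne
      have hw : ∑ y, (Pi.single t 1 : 𝕊 → ℝ) y = 1 := by simp
      have hch : IsChannel (fun _ : 𝕊 => (Pi.single t 1 : 𝕊 → ℝ)) Shat_O := by
        refine ⟨fun _ y => ?_, fun _ => hw, fun _ y hy => ?_⟩
        · exact (Pi.single_nonneg.2 zero_le_one : (0 : 𝕊 → ℝ) ≤ Pi.single t 1) y
        · by_contra hyS
          exact hy (Pi.single_eq_of_ne (fun h => hyS (by rwa [h])) 1)
      refine sInf_le ⟨_, hch, le_of_eq_of_le ?_ hD, ?_⟩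
      · refine Finset.sum_eq_zero fun x _ => Finset.sum_eq_zero fun y _ => ?_
        by_cases hx : x ∈ A
        · have h := (Finset.sum_eq_zero_iff_of_nonneg fun x _ => by
            split_ifs
            exacts [hp0 x, le_rfl]).1 hP x (Finset.mem_univ x)
          rw [if_pos hx] at h
          rw [h, zero_mul, zero_mul]
        · rw [mul_assoc, hd _ hch x hx y, mul_zero]
      · rw [mutualInfo_const hp1 hw, EReal.coe_zero]
    · refine le_sInf ?_
      rintro _ ⟨W, hW, -, rfl⟩
      exact EReal.coe_nonneg.2 (mutualInfo_nonneg hp0 hp1 hW.1 hW.2.1)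
  · have hP' := hP.ne'
    have hπ0 : ∀ x, 0 ≤ condOn p A x := by
      intro x
      unfold condOn
      split_ifs
      exacts [div_nonneg (hp0 x) hP.le, le_rfl]
    have hπ1 : ∑ x, condOn p A x = 1 := sum_condOn hP'
    apply le_antisymm
    · rw [← EReal.div_le_iff_le_mul (EReal.coe_pos.2 hP) (EReal.coe_ne_top _)]
      refine le_sInf ?_
      rintro _ ⟨V, hV, hVD, rfl⟩
      rw [EReal.div_le_iff_le_mul (EReal.coe_pos.2 hP) (EReal.coe_ne_top _)]
      have hW := hV.extendChannel (A := A) hπ0 hπ1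
      refine sInf_le ⟨_, hW, ?_, ?_⟩
      · rw [sum_distortion_eq (W := extendChannel A (condOn p A) V) (V := V) hP'
            (fun x hx => funext fun y => if_pos hx) (hd _ hW),
          mul_comm]
        exact (le_div_iff₀ hP).1 hVD
      · rw [mutualInfo_extendChannel hp1 hP' hV.2.1, EReal.coe_mul]
    · refine le_sInf ?_
      rintro _ ⟨W, hW, hWD, rfl⟩
      have hle : ∀ x, massOn p A * condOn p A x ≤ p x := by
        intro x
        rw [massOn_mul_condOn hP']
        split_ifs
        exacts [le_rfl, hp0 x]
      refine le_trans (mul_le_mul_of_nonneg_left (sInf_le ⟨W, hW, ?_, rfl⟩)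
        (EReal.coe_nonneg.2 hP.le)) ?_
      · rw [le_div_iff₀ hP, mul_comm, ← sum_distortion_eq hP' (fun _ _ => rfl) (hd W hW)]
        exact hWD
      · rw [← EReal.coe_mul]
        exact EReal.coe_le_coe_iff.2
          (mul_mutualInfo_le hp1 hπ0 hπ1 hP.le hle hW.1 hW.2.1)

end
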